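/- Let ξ < b be real, let n ≥ 1 be an integer, and let g ∈ C^∞[ξ,b] with g'(ξ) = g''(ξ) = … = g^{(n)}(ξ) = 0, g^{(n+1)}(ξ) > 0 and g'(x) > 0 for x ∈ (ξ,b]. Let G : [g(ξ), g(b)] → [ξ,b] be the inverse of g on [ξ,b] and set α := 1/(n+1). Then for every integer p ≥ 1 there exists a constant C_p > 0 such that |G^{(p)}(τ)| ≤ C_p (τ − g(ξ))^{α − p} for all τ ∈ (g(ξ), g(b)]. -/

import Mathlib

open Set Filter Topology

/-- `f` is smooth on `s` and its derivatives of order `< m` within `s` vanish at `a`. -/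
def VanishesToOrder (f : ℝ → ℝ) (s : Set ℝ) (a : ℝ) (m : ℕ) : Prop :=
  ContDiffOn ℝ (⊤ : ℕ∞) f s ∧ ∀ j < m, iteratedDerivWithin j f s a = 0

namespace VanishesToOrder

variable {f h : ℝ → ℝ} {s : Set ℝ} {a b : ℝ} {m k N : ℕ}

theorem of_contDiffOn (hf : ContDiffOn ℝ (⊤ : ℕ∞) f s) : VanishesToOrder f s a 0 :=
  ⟨hf, fun _ hj => absurd hj (Nat.not_lt_zero _)⟩

theorem mono (hf : VanishesToOrder f s a m) (hk : k ≤ m) : VanishesToOrder f s a k :=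
  ⟨hf.1, fun j hj => hf.2 j (hj.trans_le hk)⟩

theorem differentiableOn (hf : VanishesToOrder f s a m) : DifferentiableOn ℝ f s :=
  hf.1.differentiableOn (by simp)

theorem hasDerivWithinAt (hf : VanishesToOrder f s a m) {x : ℝ} (hx : x ∈ s) :
    HasDerivWithinAt f (derivWithin f s x) s x :=
  (hf.differentiableOn x hx).hasDerivWithinAt

theorem apply_eq_zero (hf : VanishesToOrder f s a m) (hm : 0 < m) : f a = 0 := by
  simpa using hf.2 0 hm

theorem derivWithin (hs : UniqueDiffOn ℝ s) (hf : VanishesToOrder f s a m) :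
    VanishesToOrder (derivWithin f s) s a (m - 1) := by
  refine ⟨hf.1.derivWithin hs le_rfl, fun j hj => ?_⟩
  rw [← iteratedDerivWithin_succ']
  exact hf.2 (j + 1) (by omega)

theorem of_derivWithin (hf : ContDiffOn ℝ (⊤ : ℕ∞) f s) (ha : f a = 0)
    (hf' : VanishesToOrder (_root_.derivWithin f s) s a m) : VanishesToOrder f s a (m + 1) := by
  refine ⟨hf, fun j hj => ?_⟩
  cases j with
  | zero => simpa using ha
  | succ j =>
    rw [iteratedDerivWithin_succ']
    exact hf'.2 j (by omega)

theorem congr (hf : VanishesToOrder f s a m) (ha : a ∈ s) (hfh : EqOn h f s) :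
    VanishesToOrder h s a m :=
  ⟨hf.1.congr hfh, fun j hj => (iteratedDerivWithin_congr hfh ha).trans (hf.2 j hj)⟩

theorem add (hs : UniqueDiffOn ℝ s) (ha : a ∈ s) (hf : VanishesToOrder f s a m)
    (hh : VanishesToOrder h s a m) : VanishesToOrder (fun x => f x + h x) s a m := by
  refine ⟨hf.1.add hh.1, fun j hj => ?_⟩
  have h1 : ContDiffWithinAt ℝ j f s a := (hf.1 a ha).of_le (by exact_mod_cast le_top)
  have h2 : ContDiffWithinAt ℝ j h s a := (hh.1 a ha).of_le (by exact_mod_cast le_top)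
  rw [iteratedDerivWithin_fun_add ha hs h1 h2, hf.2 j hj, hh.2 j hj, add_zero]

theorem mul (hs : UniqueDiffOn ℝ s) (ha : a ∈ s) (hf : VanishesToOrder f s a m)
    (hh : VanishesToOrder h s a k) (hN : N ≤ m + k) :
    VanishesToOrder (fun x => f x * h x) s a N := by
  induction N generalizing f h m k with
  | zero => exact of_contDiffOn (hf.1.mul hh.1)
  | succ N ih =>
    refine of_derivWithin (hf.1.mul hh.1) ?_ ?_
    · rcases Nat.eq_zero_or_pos m with hm | hm
      · rw [hh.apply_eq_zero (by omega), mul_zero]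
      · rw [hf.apply_eq_zero hm, zero_mul]
    · have h1 := ih (hf.derivWithin hs) hh (by omega)
      have h2 := ih hf (hh.derivWithin hs) (by omega)
      refine (h1.add hs ha h2).congr ha fun x hx => ?_
      exact ((hf.hasDerivWithinAt hx).fun_mul (hh.hasDerivWithinAt hx)).derivWithin (hs x hx)

theorem const_mul (hs : UniqueDiffOn ℝ s) (ha : a ∈ s) (c : ℝ) (hf : VanishesToOrder f s a m) :
    VanishesToOrder (fun x => c * f x) s a m :=
  (of_contDiffOn (a := a) (contDiffOn_const (c := c))).mul hs ha hf (by omega)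

theorem exists_bound (hab : a < b) (hf : VanishesToOrder f (Icc a b) a m) :
    ∃ C : ℝ, 0 < C ∧ ∀ x ∈ Icc a b, |f x| ≤ C * (x - a) ^ m := by
  induction m generalizing f with
  | zero =>
    obtain ⟨C, hC⟩ := isCompact_Icc.exists_bound_of_continuousOn hf.1.continuousOn
    refine ⟨max C 1, by positivity, fun x hx => ?_⟩
    simpa using Or.inl (hC x hx)
  | succ m ih =>
    obtain ⟨C, hC, hbound⟩ := ih (hf.derivWithin (uniqueDiffOn_Icc hab))
    refine ⟨C, hC, fun x hx => ?_⟩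
    have hsub : Icc a x ⊆ Icc a b := Icc_subset_Icc_right hx.2
    have h := norm_image_sub_le_of_norm_deriv_le_segment' (C := C * (x - a) ^ m)
      (fun y hy => (hf.hasDerivWithinAt (hsub hy)).mono hsub)
      (fun y hy => (hbound y (hsub (Ico_subset_Icc_self hy))).trans
        (by have := hy.1; have := hy.2.le; gcongr)) x (right_mem_Icc.2 hx.1)
    rwa [hf.apply_eq_zero (Nat.succ_pos m), sub_zero, Real.norm_eq_abs, mul_assoc, ← pow_succ] at h

theorem exists_local_lower_bound (hab : a < b) (hf : VanishesToOrder f (Icc a b) a m)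
    (hpos : 0 < iteratedDerivWithin m f (Icc a b) a) :
    ∃ c > 0, ∃ d ∈ Ioc a b, ∀ x ∈ Icc a d, c * (x - a) ^ m ≤ f x := by
  induction m generalizing f with
  | zero =>
    rw [iteratedDerivWithin_zero] at hpos
    have hev : ∀ᶠ x in 𝓝[≥] a, f a / 2 < f x := by
      rw [← nhdsWithin_Icc_eq_nhdsGE hab]
      exact (hf.1.continuousOn a (left_mem_Icc.2 hab.le)).eventually_const_lt (half_lt_self hpos)
    obtain ⟨d, hd, hsub⟩ := (mem_nhdsGE_iff_exists_Icc_subset).1 hev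
    refine ⟨f a / 2, half_pos hpos, min d b, ⟨lt_min hd hab, min_le_right _ _⟩, fun x hx => ?_⟩
    simpa using (hsub ⟨hx.1, hx.2.trans (min_le_left _ _)⟩ : f a / 2 < f x).le
  | succ m ih =>
    obtain ⟨c, hc, d, hd, hlow⟩ := ih (hf.derivWithin (uniqueDiffOn_Icc hab))
      (by rwa [← iteratedDerivWithin_succ'])
    refine ⟨c / (m + 1), by positivity, d, hd, ?_⟩
    have hsub : Icc a d ⊆ Icc a b := Icc_subset_Icc_right hd.2
    have hderiv : ∀ y ∈ Icc a d, HasDerivWithinAt (fun y => f y - c / (m + 1) * (y - a) ^ (m + 1))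
        (_root_.derivWithin f (Icc a b) y - c * (y - a) ^ m) (Icc a d) y := by
      intro y hy
      refine ((hf.hasDerivWithinAt (hsub hy)).mono hsub).fun_sub ?_
      refine ((((hasDerivAt_id' y).hasDerivWithinAt.sub_const a).fun_pow (m + 1)).const_mul
        (c / (m + 1))).congr_deriv ?_
      rw [Nat.add_sub_cancel]
      push_cast
      field_simp
    have hmono : MonotoneOn (fun y => f y - c / (m + 1) * (y - a) ^ (m + 1)) (Icc a d) := by
      refine monotoneOn_of_hasDerivWithinAt_nonneg (convex_Icc a d)
        (fun y hy => (hderiv y hy).continuousWithinAt)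
        (fun y hy => (hderiv y (interior_subset hy)).mono interior_subset)
        (fun y hy => sub_nonneg.2 (hlow y (interior_subset hy)))
    intro x hx
    have h := hmono (left_mem_Icc.2 hd.1.le) hx hx.1
    simp only [hf.apply_eq_zero (Nat.succ_pos m), sub_self] at h
    simpa using h

theorem exists_lower_bound (hab : a < b) (hf : VanishesToOrder f (Icc a b) a m)
    (hpos : 0 < iteratedDerivWithin m f (Icc a b) a) (hf_pos : ∀ x ∈ Ioc a b, 0 < f x) :
    ∃ c : ℝ, 0 < c ∧ ∀ x ∈ Icc a b, c * (x - a) ^ m ≤ f x := by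
  obtain ⟨c, hc, d, hd, hlow⟩ := hf.exists_local_lower_bound hab hpos
  have hsub : Icc d b ⊆ Icc a b := Icc_subset_Icc_left hd.1.le
  obtain ⟨y, hy, hmin⟩ := isCompact_Icc.exists_isMinOn (nonempty_Icc.2 hd.2)
    (hf.1.continuousOn.mono hsub)
  have hfy : 0 < f y := hf_pos y ⟨hd.1.trans_le hy.1, hy.2⟩
  have hba : 0 < b - a := sub_pos.2 hab
  refine ⟨min c (f y / (b - a) ^ m), by positivity, fun x hx => ?_⟩
  have hxa : 0 ≤ x - a := sub_nonneg.2 hx.1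
  rcases le_total x d with hxd | hxd
  · refine le_trans ?_ (hlow x ⟨hx.1, hxd⟩)
    gcongr
    exact min_le_left _ _
  · refine le_trans ?_ (hmin ⟨hxd, hx.2⟩)
    calc min c (f y / (b - a) ^ m) * (x - a) ^ m
        ≤ f y / (b - a) ^ m * (b - a) ^ m := by
          gcongr
          · exact min_le_right _ _
          · exact hx.2
      _ = f y := by field_simp

end VanishesToOrder

section Inverse

variable {g G : ℝ → ℝ} {ξ b : ℝ} {n : ℕ}

theorem exists_sub_bound (hξb : ξ < b) (hg : ContDiffOn ℝ (⊤ : ℕ∞) g (Icc ξ b))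
    (hg1 : VanishesToOrder (derivWithin g (Icc ξ b)) (Icc ξ b) ξ n) :
    ∃ C : ℝ, 0 < C ∧ ∀ x ∈ Icc ξ b, |g x - g ξ| ≤ C * (x - ξ) ^ (n + 1) := by
  refine VanishesToOrder.exists_bound (f := fun x => g x - g ξ) hξb
    (.of_derivWithin (hg.sub contDiffOn_const) (sub_self _)
      (hg1.congr (left_mem_Icc.2 hξb.le) fun x _ => ?_))
  exact derivWithin_sub_const (g ξ)

theorem inverse_mem_Icc (hξb : ξ < b) (hg : ContinuousOn g (Icc ξ b))
    (hGg : ∀ x ∈ Icc ξ b, G (g x) = x) : MapsTo G (Icc (g ξ) (g b)) (Icc ξ b) := by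
  intro τ hτ
  obtain ⟨x, hx, rfl⟩ := intermediate_value_Icc hξb.le hg hτ
  rwa [hGg x hx]

theorem inverse_mem_Ioc (hξb : ξ < b) (hg : ContinuousOn g (Icc ξ b))
    (hGg : ∀ x ∈ Icc ξ b, G (g x) = x) : MapsTo G (Ioc (g ξ) (g b)) (Ioc ξ b) := by
  intro τ hτ
  obtain ⟨x, hx, rfl⟩ := intermediate_value_Icc hξb.le hg (Ioc_subset_Icc_self hτ)
  rw [hGg x hx]
  refine ⟨lt_of_le_of_ne hx.1 ?_, hx.2⟩
  rintro rfl
  exact lt_irrefl _ hτ.1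

/-- A left inverse of a continuous function on a compact set is continuous on the image. -/
theorem IsCompact.continuousOn_of_leftInvOn {X Y : Type*} [TopologicalSpace X]
    [TopologicalSpace Y] [T2Space Y] {g : X → Y} {G : Y → X} {s : Set X} (hs : IsCompact s)
    (hg : ContinuousOn g s) (hG : LeftInvOn G g s) : ContinuousOn G (g '' s) := by
  rw [continuousOn_iff_isClosed]
  intro t ht
  refine ⟨g '' (s ∩ t), ((hs.inter_right ht).image_of_continuousOn
    (hg.mono inter_subset_left)).isClosed, ?_⟩
  ext y
  constructor
  · rintro ⟨hy, x, hx, rfl⟩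
    rw [mem_preimage, hG hx] at hy
    exact ⟨⟨x, ⟨hx, hy⟩, rfl⟩, x, hx, rfl⟩
  · rintro ⟨⟨x, ⟨hx, hxt⟩, rfl⟩, hy⟩
    refine ⟨?_, hy⟩
    rwa [mem_preimage, hG hx]

theorem hasDerivWithinAt_inverse (hξb : ξ < b) (hg : ContDiffOn ℝ (⊤ : ℕ∞) g (Icc ξ b))
    (hg' : ∀ x ∈ Ioc ξ b, 0 < derivWithin g (Icc ξ b) x)
    (hGg : ∀ x ∈ Icc ξ b, G (g x) = x)
    (hgG : ∀ τ ∈ Icc (g ξ) (g b), g (G τ) = τ) {τ : ℝ} (hτ : τ ∈ Ioc (g ξ) (g b)) :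
    HasDerivWithinAt G (derivWithin g (Icc ξ b) (G τ))⁻¹ (Icc (g ξ) (g b)) τ := by
  have hτ' := Ioc_subset_Icc_self hτ
  have hmaps := inverse_mem_Icc hξb hg.continuousOn hGg
  have hx := inverse_mem_Ioc hξb hg.continuousOn hGg hτ
  have hcont : ContinuousOn G (Icc (g ξ) (g b)) :=
    (isCompact_Icc.continuousOn_of_leftInvOn hg.continuousOn hGg).mono
      (intermediate_value_Icc hξb.le hg.continuousOn)
  have hd : HasDerivWithinAt g (derivWithin g (Icc ξ b) (G τ)) (Icc ξ b) (G τ) :=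
    (hg.differentiableOn (by simp) _ (Ioc_subset_Icc_self hx)).hasDerivWithinAt
  have htend : Tendsto G (𝓝[Icc (g ξ) (g b)] τ) (𝓝[Icc ξ b] (G τ)) :=
    tendsto_nhdsWithin_of_tendsto_nhds_of_eventually_within _ (hcont τ hτ')
      (eventually_mem_nhdsWithin.mono fun _ hy => hmaps hy)
  simpa using (HasFDerivWithinAt.of_local_left_inverse htend
    (f' := ContinuousLinearEquiv.unitsEquivAut ℝ (Units.mk0 _ (hg' _ hx).ne'))
    hd.hasFDerivWithinAt hτ' (eventually_mem_nhdsWithin.mono hgG)).hasDerivWithinAt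

/-- The derivatives of the inverse of `g` are `G^{(p+1)}(g(x)) = P(x) / g'(x)^{2p+1}`, where the
smooth numerator `P` inherits vanishing at `ξ` from `g'`. -/
theorem exists_iteratedDerivWithin_inverse_eq (hξb : ξ < b)
    (hg : ContDiffOn ℝ (⊤ : ℕ∞) g (Icc ξ b))
    (hg1 : VanishesToOrder (derivWithin g (Icc ξ b)) (Icc ξ b) ξ n)
    (hg' : ∀ x ∈ Ioc ξ b, 0 < derivWithin g (Icc ξ b) x)
    (hGg : ∀ x ∈ Icc ξ b, G (g x) = x)
    (hgG : ∀ τ ∈ Icc (g ξ) (g b), g (G τ) = τ) (p : ℕ) :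
    ∃ P : ℝ → ℝ, VanishesToOrder P (Icc ξ b) ξ (p * (n - 1)) ∧
      ∀ τ ∈ Ioc (g ξ) (g b), iteratedDerivWithin (p + 1) G (Icc (g ξ) (g b)) τ =
        P (G τ) / derivWithin g (Icc ξ b) (G τ) ^ (2 * p + 1) := by
  have hs := uniqueDiffOn_Icc hξb
  have hξ : ξ ∈ Icc ξ b := left_mem_Icc.2 hξb.le
  have hmaps := inverse_mem_Icc hξb hg.continuousOn hGg
  induction p with
  | zero =>
    refine ⟨fun _ => 1, by simpa using .of_contDiffOn contDiffOn_const, fun τ hτ => ?_⟩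
    have hD := uniqueDiffOn_Icc (hτ.1.trans_le hτ.2)
    rw [zero_add, iteratedDerivWithin_one,
      (hasDerivWithinAt_inverse hξb hg hg' hGg hgG hτ).derivWithin (hD τ (Ioc_subset_Icc_self hτ))]
    simp
  | succ p ih =>
    obtain ⟨P, hP, hformula⟩ := ih
    have h1 : VanishesToOrder (fun x => derivWithin P (Icc ξ b) x * derivWithin g (Icc ξ b) x)
        (Icc ξ b) ξ ((p + 1) * (n - 1)) :=
      (hP.derivWithin hs).mul hs hξ hg1 (by cases n <;> simp [add_mul]; omega)
    have h2 : VanishesToOrder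
        (fun x => P x * derivWithin (derivWithin g (Icc ξ b)) (Icc ξ b) x)
        (Icc ξ b) ξ ((p + 1) * (n - 1)) :=
      hP.mul hs hξ (hg1.derivWithin hs) (by rw [add_mul, one_mul])
    refine ⟨_, h1.add hs hξ (h2.const_mul hs hξ (-(2 * p + 1))), fun τ hτ => ?_⟩
    have hτ' := Ioc_subset_Icc_self hτ
    have hD := uniqueDiffOn_Icc (hτ.1.trans_le hτ.2)
    have hne := (hg' _ (inverse_mem_Ioc hξb hg.continuousOn hGg hτ)).ne'
    have hG := hasDerivWithinAt_inverse hξb hg hg' hGg hgG hτ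
    have hPG := (hP.hasDerivWithinAt (hmaps hτ')).comp τ hG hmaps
    have hgG' := ((hg1.hasDerivWithinAt (hmaps hτ')).comp τ hG hmaps).fun_pow (2 * p + 1)
    have hev : iteratedDerivWithin (p + 1) G (Icc (g ξ) (g b)) =ᶠ[𝓝[Icc (g ξ) (g b)] τ]
        fun y => (P ∘ G) y / (derivWithin g (Icc ξ b) ∘ G) y ^ (2 * p + 1) := by
      filter_upwards [eventually_mem_nhdsWithin, mem_nhdsWithin_of_mem_nhds (Ioi_mem_nhds hτ.1)]
        with y hy hy'
      exact hformula y ⟨hy', hy.2⟩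
    rw [iteratedDerivWithin_succ, ((hPG.fun_div hgG'
      (pow_ne_zero _ hne)).congr_of_eventuallyEq_of_mem hev hτ').derivWithin (hD τ hτ')]
    simp only [Function.comp_apply, Nat.add_sub_cancel]
    generalize derivWithin g (Icc ξ b) (G τ) = y at hne
    push_cast
    field_simp
    ring

end Inverse

/-- Let `ξ < b`, `n ≥ 1`, and `g ∈ C^∞[ξ,b]` with a stationary point of
order `n` at `ξ` (`g'(ξ) = … = g^{(n)}(ξ) = 0`, `g^{(n+1)}(ξ) > 0`) and `g' > 0` on
`(ξ,b]`.  If `G` is the inverse of `g` on `[ξ,b]` and `α = 1/(n+1)`, then for every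
`p ≥ 1` there is `C_p > 0` with `|G^{(p)}(τ)| ≤ C_p (τ − g(ξ))^{α−p}` on `(g(ξ), g(b)]`. -/
theorem inverse_derivative_estimate (ξ b : ℝ) (hξb : ξ < b) (n : ℕ) (hn : 1 ≤ n)
    (g G : ℝ → ℝ)
    (hg : ContDiffOn ℝ (⊤ : ℕ∞) g (Set.Icc ξ b))
    (hstat : ∀ j : ℕ, 1 ≤ j → j ≤ n → iteratedDerivWithin j g (Set.Icc ξ b) ξ = 0)
    (hpos : 0 < iteratedDerivWithin (n + 1) g (Set.Icc ξ b) ξ)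
    (hg' : ∀ x ∈ Set.Ioc ξ b, 0 < derivWithin g (Set.Icc ξ b) x)
    (hGg : ∀ x ∈ Set.Icc ξ b, G (g x) = x)
    (hgG : ∀ τ ∈ Set.Icc (g ξ) (g b), g (G τ) = τ) :
    ∀ p : ℕ, 1 ≤ p → ∃ C : ℝ, 0 < C ∧
      ∀ τ ∈ Set.Ioc (g ξ) (g b),
        |iteratedDerivWithin p G (Set.Icc (g ξ) (g b)) τ| ≤
          C * (τ - g ξ) ^ ((1 : ℝ) / ((n : ℝ) + 1) - (p : ℝ)) := by
  have hu : UniqueDiffOn ℝ (Set.Icc ξ b) := uniqueDiffOn_Icc hξb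
  have hg1 : VanishesToOrder (derivWithin g (Set.Icc ξ b)) (Set.Icc ξ b) ξ n := by
    refine ⟨hg.derivWithin hu le_rfl, fun j hj => ?_⟩
    rw [← iteratedDerivWithin_succ']
    exact hstat (j + 1) (by omega) (by omega)
  obtain ⟨c, hc, hlow⟩ := hg1.exists_lower_bound hξb
    (by rwa [← iteratedDerivWithin_succ']) hg'
  obtain ⟨C₂, hC₂, hup⟩ := exists_sub_bound hξb hg hg1
  intro p hp
  obtain ⟨p, rfl⟩ : ∃ q, p = q + 1 := ⟨p - 1, by omega⟩
  obtain ⟨P, hP, hformula⟩ := exists_iteratedDerivWithin_inverse_eq hξb hg hg1 hg' hGg hgG p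
  obtain ⟨C₁, hC₁, hPb⟩ := hP.exists_bound hξb
  set β : ℝ := 1 / ((n : ℝ) + 1) - ((p + 1 : ℕ) : ℝ) with hβ
  refine ⟨C₁ / c ^ (2 * p + 1) * C₂ ^ (-β), by positivity, fun τ hτ => ?_⟩
  have hx := inverse_mem_Ioc hξb hg.continuousOn hGg hτ
  have hxτ := hgG τ (Set.Ioc_subset_Icc_self hτ)
  rw [hformula τ hτ]
  generalize G τ = x at hx hxτ
  subst hxτ
  have ht : 0 < x - ξ := sub_pos.2 hx.1
  have hxs := Set.Ioc_subset_Icc_self hx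
  have hτ0 : 0 < g x - g ξ := sub_pos.2 hτ.1
  have hβ0 : β ≤ 0 := by
    have h1 : (1 : ℝ) / ((n : ℝ) + 1) ≤ 1 := by
      rw [div_le_one (by positivity)]
      linarith [(Nat.cast_nonneg n : (0 : ℝ) ≤ n)]
    have h2 : (0 : ℝ) ≤ p := Nat.cast_nonneg p
    rw [hβ]
    push_cast
    linarith
  have hτle : g x - g ξ ≤ C₂ * (x - ξ) ^ (n + 1) := (le_abs_self _).trans (hup x hxs)
  have hpow : ((x - ξ) ^ (n + 1)) ^ β = ((x - ξ) ^ (p * n + p + n))⁻¹ := by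
    rw [← Real.rpow_natCast, ← Real.rpow_mul ht.le, ← Real.rpow_natCast, ← Real.rpow_neg ht.le]
    congr 1
    rw [hβ]
    push_cast
    field_simp
    ring
  have hmain : C₂ ^ β * ((x - ξ) ^ (p * n + p + n))⁻¹ ≤ (g x - g ξ) ^ β := by
    rw [← hpow, ← Real.mul_rpow hC₂.le (by positivity)]
    exact Real.rpow_le_rpow_of_nonpos hτ0 hτle hβ0
  have hexp : p * (n - 1) + (p * n + p + n) = n * (2 * p + 1) := by
    obtain ⟨k, rfl⟩ : ∃ k, n = k + 1 := ⟨n - 1, by omega⟩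
    simp only [Nat.add_sub_cancel]
    ring
  have hd := hlow x hxs
  have hd0 : 0 < derivWithin g (Set.Icc ξ b) x := hg' x hx
  calc |P x / derivWithin g (Set.Icc ξ b) x ^ (2 * p + 1)|
      = |P x| / derivWithin g (Set.Icc ξ b) x ^ (2 * p + 1) := by
        rw [abs_div, abs_of_pos (pow_pos hd0 _)]
    _ ≤ C₁ * (x - ξ) ^ (p * (n - 1)) / (c * (x - ξ) ^ n) ^ (2 * p + 1) := by
        gcongr
        exact hPb x hxs
    _ = C₁ / c ^ (2 * p + 1) * ((x - ξ) ^ (p * n + p + n))⁻¹ := by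
        rw [mul_pow, ← pow_mul, ← hexp, pow_add (x - ξ) (p * (n - 1))]
        field_simp
    _ = C₁ / c ^ (2 * p + 1) * C₂ ^ (-β) * (C₂ ^ β * ((x - ξ) ^ (p * n + p + n))⁻¹) := by
        rw [Real.rpow_neg hC₂.le]
        have : C₂ ^ β ≠ 0 := (Real.rpow_pos_of_pos hC₂ _).ne'
        field_simp
    _ ≤ C₁ / c ^ (2 * p + 1) * C₂ ^ (-β) * (g x - g ξ) ^ β := by
        gcongr
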